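/- Let V be the complex vector space with basis {e_m : m ∈ ℤ_{≥0}^n}, fix t = q^{2α} ∈ (0,1), and equip V with the inner product making the e_m pairwise orthogonal with ⟨e_m, e_m⟩ = ∏_{i=1}^{n} (q²;q²)_{m_i} / (t q^{2n+2};q²)_{|m|}. Define ẑ_i e_m = q^{m_{i+1}+…+m_n} e_{m+ε_i} and ẑ*_i e_m = q^{m_{i+1}+…+m_n} (1 − q^{2m_i})/(1 − t q^{2|m|+2n}) e_{m−ε_i} (interpreted as 0 when m_i = 0). Then for every i and all u, v ∈ V: ⟨ẑ_i u, v⟩ = ⟨u, ẑ*_i v⟩, i.e. ẑ*_i is the adjoint of ẑ_i with respect to this inner product. -/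

import Mathlib

/-- The q²-shifted factorial `(a; q²)_m = ∏_{j=0}^{m-1} (1 − a q^{2j})`. -/
noncomputable def qpochC (q : ℝ) (a : ℂ) (m : ℕ) : ℂ :=
  ∏ j ∈ Finset.range m, (1 - a * (q : ℂ) ^ (2 * j))

/-- The squared norm `⟨e_m, e_m⟩ = ∏_{i=1}^{n} (q²;q²)_{m_i} / (tq^{2n+2};q²)_{|m|}` of the
monomial `z^m` in the q-weighted Bergman space with `t = q^{2α}`. -/
noncomputable def bw (q t : ℝ) (n : ℕ) (m : Fin n → ℕ) : ℂ :=
  (∏ i : Fin n, qpochC q ((q : ℂ) ^ 2) (m i)) /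
    qpochC q ((t : ℂ) * (q : ℂ) ^ (2 * n + 2)) (∑ i, m i)

/-- The inner product on the vector space with orthogonal basis `{e_m}` and
`⟨e_m, e_m⟩ = bw q t n m`. -/
noncomputable def bip (q t : ℝ) (n : ℕ) (u v : (Fin n → ℕ) →₀ ℂ) : ℂ :=
  ∑ m ∈ u.support, (starRingEnd ℂ) (u m) * v m * bw q t n m

theorem bip_eq_sum (q t : ℝ) (n : ℕ) (u v : (Fin n → ℕ) →₀ ℂ) :
    bip q t n u v = u.sum fun m a => (starRingEnd ℂ) a * v m * bw q t n m := rfl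

theorem bip_add_left (q t : ℝ) (n : ℕ) (u u' v : (Fin n → ℕ) →₀ ℂ) :
    bip q t n (u + u') v = bip q t n u v + bip q t n u' v := by
  simp only [bip_eq_sum]
  exact Finsupp.sum_add_index' (by simp) (by intros; rw [map_add]; ring)

theorem bip_single_left (q t : ℝ) (n : ℕ) (m : Fin n → ℕ) (a : ℂ) (v : (Fin n → ℕ) →₀ ℂ) :
    bip q t n (Finsupp.single m a) v = (starRingEnd ℂ) a * v m * bw q t n m := by
  rw [bip_eq_sum, Finsupp.sum_single_index (by simp)]

theorem qpochC_succ (q : ℝ) (a : ℂ) (m : ℕ) :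
    qpochC q a (m + 1) = qpochC q a m * (1 - a * (q : ℂ) ^ (2 * m)) :=
  Finset.prod_range_succ _ _

theorem sum_add_single_one {n : ℕ} (m : Fin n → ℕ) (i : Fin n) :
    ∑ j, (m + Pi.single i 1 : Fin n → ℕ) j = ∑ j, m j + 1 := by
  simp [Finset.sum_add_distrib]

theorem sum_filter_add_single_one {n : ℕ} (m : Fin n → ℕ) (i : Fin n) :
    ∑ j ∈ Finset.univ.filter (fun j => i < j), (m + Pi.single i 1 : Fin n → ℕ) j =
      ∑ j ∈ Finset.univ.filter (fun j => i < j), m j := by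
  refine Finset.sum_congr rfl fun j hj => ?_
  have hij : j ≠ i := (Finset.mem_filter.mp hj).2.ne'
  simp [hij]

theorem prod_qpochC_add_single_one (q : ℝ) (a : ℂ) {n : ℕ} (m : Fin n → ℕ) (i : Fin n) :
    ∏ j, qpochC q a ((m + Pi.single i 1 : Fin n → ℕ) j) =
      (∏ j, qpochC q a (m j)) * (1 - a * (q : ℂ) ^ (2 * m i)) := by
  rw [← Finset.mul_prod_erase _ _ (Finset.mem_univ i),
    ← Finset.mul_prod_erase _ (fun j => qpochC q a (m j)) (Finset.mem_univ i)]
  have h : ∏ j ∈ Finset.univ.erase i, qpochC q a ((m + Pi.single i 1 : Fin n → ℕ) j) =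
      ∏ j ∈ Finset.univ.erase i, qpochC q a (m j) := by
    refine Finset.prod_congr rfl fun j hj => ?_
    simp [Finset.ne_of_mem_erase hj]
  rw [h, Pi.add_apply, Pi.single_eq_same, qpochC_succ]
  ring

theorem bw_add_single_one (q t : ℝ) {n : ℕ} (m : Fin n → ℕ) (i : Fin n) :
    bw q t n (m + Pi.single i 1) =
      (1 - (q : ℂ) ^ (2 * (m i + 1))) /
        (1 - (t : ℂ) * (q : ℂ) ^ (2 * (∑ j, m j + 1) + 2 * n)) * bw q t n m := by
  rw [bw, bw, sum_add_single_one, prod_qpochC_add_single_one, qpochC_succ, mul_div_mul_comm,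
    mul_comm]
  congr 3 <;> ring

/-- A weighted backward shift in direction `i` whose weight vanishes on `m i = 0` acts on
coefficients as a weighted forward shift of the argument. -/
theorem backward_shift_apply {n : ℕ} (i : Fin n) (c : (Fin n → ℕ) → ℂ)
    (T : Module.End ℂ ((Fin n → ℕ) →₀ ℂ))
    (hT : ∀ m, T (Finsupp.single m 1) = c m • Finsupp.single (m - Pi.single i 1) 1)
    (hc : ∀ m, m i = 0 → c m = 0) (v : (Fin n → ℕ) →₀ ℂ) (m : Fin n → ℕ) :
    T v m = c (m + Pi.single i 1) * v (m + Pi.single i 1) := by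
  induction v using Finsupp.induction_linear with
  | zero => simp
  | add f g hf hg => rw [map_add, Finsupp.add_apply, hf, hg, Finsupp.add_apply, mul_add]
  | single k a =>
    rw [← mul_one a, ← smul_eq_mul, ← Finsupp.smul_single, map_smul, hT]
    simp only [Finsupp.smul_apply, smul_eq_mul]
    by_cases hk : k = m + Pi.single i 1
    · subst hk
      simp only [add_tsub_cancel_right, Finsupp.single_eq_same]
      ring
    · rw [Finsupp.single_eq_of_ne' hk]
      by_cases hki : k i = 0
      · simp [hc k hki]
      · have hle : Pi.single i 1 ≤ k := by
          intro j
          rcases eq_or_ne j i with rfl | hj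
          · simpa [Nat.one_le_iff_ne_zero] using hki
          · simp [hj]
        have hne : k - Pi.single i 1 ≠ m := fun h => hk (by rw [← h, tsub_add_cancel_of_le hle])
        rw [Finsupp.single_eq_of_ne' hne]
        ring

/-- `ẑ*_i` is the adjoint of `ẑ_i` with respect to the q-weighted Bergman inner
product: `⟨ẑ_i u, v⟩ = ⟨u, ẑ*_i v⟩`. -/
theorem statement18 (q t : ℝ) (hq0 : 0 < q) (hq1 : q < 1) (ht0 : 0 < t) (ht1 : t < 1)
    (n : ℕ) (hn : 1 ≤ n)
    (zh zs : Fin n → Module.End ℂ ((Fin n → ℕ) →₀ ℂ))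
    (hzh : ∀ (i : Fin n) (m : Fin n → ℕ),
      zh i (Finsupp.single m 1) =
        ((q : ℂ) ^ (∑ j ∈ Finset.univ.filter (fun j => i < j), m j)) •
          Finsupp.single (m + Pi.single i 1) 1)
    (hzs : ∀ (i : Fin n) (m : Fin n → ℕ),
      zs i (Finsupp.single m 1) =
        ((q : ℂ) ^ (∑ j ∈ Finset.univ.filter (fun j => i < j), m j) *
            (1 - (q : ℂ) ^ (2 * m i)) /
            (1 - (t : ℂ) * (q : ℂ) ^ (2 * (∑ j, m j) + 2 * n))) •
          Finsupp.single (m - Pi.single i 1) 1) :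
    ∀ (i : Fin n) (u v : (Fin n → ℕ) →₀ ℂ),
      bip q t n (zh i u) v = bip q t n u (zs i v) := by
  intro i u v
  induction u using Finsupp.induction_linear with
  | zero => simp [bip]
  | add f g hf hg => rw [map_add, bip_add_left, bip_add_left, hf, hg]
  | single m a =>
    have hz : zh i (Finsupp.single m a) = Finsupp.single (m + Pi.single i 1)
        (a * (q : ℂ) ^ (∑ j ∈ Finset.univ.filter (fun j => i < j), m j)) := by
      rw [← mul_one a, ← smul_eq_mul, ← Finsupp.smul_single, map_smul, hzh]
      simp [Finsupp.smul_single]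
    rw [hz, bip_single_left, bip_single_left,
      backward_shift_apply i _ (zs i) (hzs i) (fun k hk => by simp [hk]),
      bw_add_single_one, sum_filter_add_single_one, sum_add_single_one,
      Pi.add_apply, Pi.single_eq_same, map_mul, map_pow, Complex.conj_ofReal]
    ring
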